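/- Let Θ = (Θ_i)_{i∈ℤ^d} be a random element of ℝ^{ℤ^d} with |Θ_0| = 1 a.s., α > 0, V Pareto(α)-distributed and independent of Θ, and Y := V·Θ. If for every s ∈ (0,1], every measurable h : ℝ^{ℤ^d} → [0,∞) and every k ∈ ℤ^d one has E[h(θ_k Y) 1{|Y_k| > s}] = s^{−α} E[h(s·Y) 1{|Y_{−k}| > 1/s}], then the time-change formula with index α holds for Θ, i.e. E[h(|Θ_k|^{−1} θ_k Θ) 1{Θ_k ≠ 0}] = E[h(Θ) |Θ_{−k}|^α] for every measurable h : ℝ^{ℤ^d} → [0,∞) and every k ∈ ℤ^d. -/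

import Mathlib

open MeasureTheory ENNReal Filter ProbabilityTheory

noncomputable section

/-- The space `ℝ^{ℤ^d}` of real-valued fields indexed by `ℤ^d`. -/
abbrev RField (d : ℕ) := (Fin d → ℤ) → ℝ

variable {d : ℕ}

/-- Shift operator: `shift k x = (x_{i+k})_i`, i.e. it moves the origin to `k`. -/
def shift (k : Fin d → ℤ) (x : RField d) : RField d := fun i => x (i + k)

/-- The set of exceedance-points of `x`. -/
def excSet (x : RField d) : Set (Fin d → ℤ) := {k | 1 < |x k|}

open Classical in
/-- Indicator (with values in `ℝ≥0∞`) of the event that `|x k| > s`. -/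
def exIndGT (s : ℝ) (k : Fin d → ℤ) (x : RField d) : ℝ≥0∞ := if s < |x k| then 1 else 0

/-- The tail-process identity:
`E[h(θ_k Y) 1{|Y_k| > 1}] = E[h(Y) 1{|Y_{−k}| > 1}]` for every measurable nonnegative `h`
and every `k ∈ ℤ^d`. -/
def TailIdentity {Ω : Type*} [MeasurableSpace Ω] (μ : Measure Ω) (Y : Ω → RField d) : Prop :=
  ∀ h : RField d → ℝ≥0∞, Measurable h → ∀ k : Fin d → ℤ,
    ∫⁻ ω, h (shift k (Y ω)) * exIndGT 1 k (Y ω) ∂μ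
      = ∫⁻ ω, h (Y ω) * exIndGT 1 (-k) (Y ω) ∂μ

/-- `Y` is exceedance-stationary: for every exceedance-map `τ` which is bijective on a
measurable set `B` (invariant under shifting the origin to exceedance-points, contained in
`ℝ₀^{ℤ^d}`) carrying the law of `Y`, we have `θ_τ Y ≐ Y`. -/
def ExcStationary {Ω : Type*} [MeasurableSpace Ω] (μ : Measure Ω) (Y : Ω → RField d) : Prop :=
  ∀ (B : Set (RField d)) (τ : RField d → Fin d → ℤ),
    MeasurableSet B → Measurable τ →
    (∀ x ∈ B, 1 < |x 0|) →
    (∀ x ∈ B, ∀ k ∈ excSet x, shift k x ∈ B) →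
    (∀ x ∈ B, τ x ∈ excSet x) →
    (∀ x ∈ B, Set.BijOn (fun k => k + τ (shift k x)) (excSet x) (excSet x)) →
    (∀ᵐ ω ∂μ, Y ω ∈ B) →
    Measure.map (fun ω => shift (τ (Y ω)) (Y ω)) μ = Measure.map Y μ

/-- `E₀`: elements of `ℝ₀^{ℤ^d}` with finitely many exceedance-points. -/
def E0set (d : ℕ) : Set (RField d) := {x | 1 < |x 0| ∧ (excSet x).Finite}

/-- `E`: elements of `ℝ^{ℤ^d}` with at least one but finitely many exceedance-points. -/
def Eset (d : ℕ) : Set (RField d) := {x | (excSet x).Nonempty ∧ (excSet x).Finite}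

/-- `l₀`: fields vanishing at infinity. -/
def l0set (d : ℕ) : Set (RField d) := {x | Tendsto (fun i => |x i|) cofinite (nhds 0)}

/-- Uniform norm `‖x‖ = sup_i |x_i|`. -/
def supNorm (x : RField d) : ℝ := ⨆ i, |x i|

/-- `V` is Pareto(α)-distributed: `P(V > y) = y^{-α}` for `y ≥ 1`. -/
def IsPareto {Ω : Type*} [MeasurableSpace Ω] (μ : Measure Ω) (V : Ω → ℝ) (α : ℝ) : Prop :=
  ∀ y : ℝ, 1 ≤ y → μ {ω | y < V ω} = ENNReal.ofReal (y ^ (-α))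

/-- An anchoring function on `S`: a measurable shift-covariant exceedance-map. -/
def IsAnchoringOn (S : Set (RField d)) (A : RField d → Fin d → ℤ) : Prop :=
  Measurable A ∧ ∀ x ∈ S, A x ∈ excSet x ∧ ∀ k ∈ excSet x, A (shift k x) + k = A x

/-- `h` is shift-invariant on `S`. -/
def ShiftInvariantOn (S : Set (RField d)) (h : RField d → ℝ≥0∞) : Prop :=
  ∀ x ∈ S, ∀ k : Fin d → ℤ, h (shift k x) = h x

open Classical in
/-- The time-change formula with index `α`:
`E[h(|Θ_k|⁻¹ θ_k Θ) 1{Θ_k ≠ 0}] = E[h(Θ) |Θ_{−k}|^α]` for all measurable `h ≥ 0`, `k ∈ ℤ^d`. -/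
def TimeChange {d : ℕ} {Ω : Type*} [MeasurableSpace Ω] (μ : Measure Ω)
    (Θ : Ω → RField d) (α : ℝ) : Prop :=
  ∀ h : RField d → ℝ≥0∞, Measurable h → ∀ k : Fin d → ℤ,
    ∫⁻ ω, (if Θ ω k = 0 then 0 else h (|Θ ω k|⁻¹ • shift k (Θ ω))) ∂μ
      = ∫⁻ ω, h (Θ ω) * ENNReal.ofReal (|Θ ω (-k)| ^ α) ∂μ

theorem measurable_shift (k : Fin d → ℤ) : Measurable (shift k : RField d → RField d) :=
  measurable_pi_lambda _ fun i => measurable_pi_apply (i + k)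

theorem measurable_exIndGT (s : ℝ) (k : Fin d → ℤ) :
    Measurable (exIndGT s k : RField d → ℝ≥0∞) := by
  unfold exIndGT
  exact Measurable.ite
    (measurableSet_lt measurable_const (continuous_abs.measurable.comp (measurable_pi_apply k)))
    measurable_const measurable_const

theorem exIndGT_antitone {s t : ℝ} (hst : s ≤ t) (k : Fin d → ℤ) (x : RField d) :
    exIndGT t k x ≤ exIndGT s k x := by
  unfold exIndGT
  split_ifs with h₁ h₂
  · exact le_rfl
  · exact absurd (hst.trans_lt h₁) h₂
  · exact zero_le_one
  · exact le_rfl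

/-- Division of a field by the modulus of its value at the origin. -/
def originNormalize (x : RField d) : RField d := |x 0|⁻¹ • x

theorem measurable_originNormalize : Measurable (originNormalize : RField d → RField d) := by
  unfold originNormalize
  fun_prop

theorem originNormalize_smul {c : ℝ} (hc : 0 < c) (x : RField d) :
    originNormalize (c • x) = originNormalize x := by
  funext i
  simp only [originNormalize, Pi.smul_apply, smul_eq_mul, abs_mul, abs_of_pos hc, mul_inv]
  field_simp

theorem shift_smul (c : ℝ) (k : Fin d → ℤ) (x : RField d) :
    shift k (c • x) = c • shift k x := rfl

theorem originNormalize_shift (k : Fin d → ℤ) (x : RField d) :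
    originNormalize (shift k x) = |x k|⁻¹ • shift k x := by
  simp [originNormalize, shift]

theorem originNormalize_of_abs_eq_one {x : RField d} (hx : |x 0| = 1) :
    originNormalize x = x := by
  simp [originNormalize, hx]

theorem IsPareto.ae_one_lt {Ω : Type*} [MeasurableSpace Ω] {μ : Measure Ω}
    [IsProbabilityMeasure μ] {V : Ω → ℝ} {α : ℝ} (hVp : IsPareto μ V α) (hV : Measurable V) :
    ∀ᵐ ω ∂μ, 1 < V ω := by
  have h := hVp 1 le_rfl
  rw [Real.one_rpow, ENNReal.ofReal_one] at h
  exact (mem_ae_iff_prob_eq_one (measurableSet_lt measurable_const hV)).2 h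

/-- The tail of `V * t` for Pareto distributed `V`, below and above the threshold. -/
theorem IsPareto.rpow_mul_measure_lt {Ω : Type*} [MeasurableSpace Ω] {μ : Measure Ω}
    [IsProbabilityMeasure μ] {V : Ω → ℝ} {α : ℝ} (hVp : IsPareto μ V α) (hV : Measurable V)
    (hα : 0 < α) {a : ℝ} (ha : 0 < a) (t : ℝ) :
    ENNReal.ofReal (a ^ α) * μ {ω | a < |V ω * t|} =
      min (ENNReal.ofReal (a ^ α)) (ENNReal.ofReal (|t| ^ α)) := by
  rcases eq_or_ne t 0 with rfl | ht
  · simp [not_lt.2 ha.le, Real.zero_rpow hα.ne']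
  have ht' : 0 < |t| := abs_pos.2 ht
  have hset : {ω | a < |V ω * t|} =ᵐ[μ] {ω | a / |t| < V ω} := by
    filter_upwards [hVp.ae_one_lt hV] with ω hω
    refine propext ?_
    change a < |V ω * t| ↔ a / |t| < V ω
    rw [abs_mul, abs_of_pos (zero_lt_one.trans hω), div_lt_iff₀ ht']
  rw [measure_congr hset]
  rcases le_total |t| a with hta | hat
  · rw [hVp _ ((one_le_div ht').2 hta), ← ENNReal.ofReal_mul (by positivity),
      min_eq_right (ENNReal.ofReal_le_ofReal (by gcongr)),
      Real.rpow_neg (by positivity), Real.div_rpow ha.le ht'.le]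
    congr 1
    have := (Real.rpow_pos_of_pos ha α).ne'
    field_simp
  · have hone : μ {ω | a / |t| < V ω} = 1 := by
      refine (mem_ae_iff_prob_eq_one (measurableSet_lt measurable_const hV)).1 ?_
      filter_upwards [hVp.ae_one_lt hV] with ω hω
      exact ((div_le_one ht').2 hat).trans_lt hω
    rw [hone, mul_one, min_eq_left (ENNReal.ofReal_le_ofReal (by gcongr))]

/-- The Pareto factor of a product with independent spectral part integrates to a truncated
moment of the spectral part. -/
theorem IsPareto.rpow_mul_lintegral_exIndGT {Ω : Type*} [MeasurableSpace Ω] {μ : Measure Ω}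
    [IsProbabilityMeasure μ] {V : Ω → ℝ} {α : ℝ} (hVp : IsPareto μ V α) (hV : Measurable V)
    (hα : 0 < α) {Θ : Ω → RField d} (hΘ : Measurable Θ) (hind : IndepFun V Θ μ)
    {h : RField d → ℝ≥0∞} (hh : Measurable h) {a : ℝ} (ha : 0 < a) (k : Fin d → ℤ) :
    ENNReal.ofReal (a ^ α) * ∫⁻ ω, h (Θ ω) * exIndGT a k (V ω • Θ ω) ∂μ =
      ∫⁻ ω, h (Θ ω) * min (ENNReal.ofReal (a ^ α)) (ENNReal.ofReal (|Θ ω k| ^ α)) ∂μ := by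
  have hsmul : Measurable fun p : RField d × ℝ => p.2 • p.1 :=
    measurable_pi_lambda _ fun i => measurable_snd.mul ((measurable_pi_apply i).comp measurable_fst)
  have hmeas : Measurable fun p : RField d × ℝ => h p.1 * exIndGT a k (p.2 • p.1) :=
    (hh.comp measurable_fst).mul ((measurable_exIndGT a k).comp hsmul)
  have hinner (x : RField d) :
      ∫⁻ v, exIndGT a k (v • x) ∂(μ.map V) = μ {ω | a < |V ω * x k|} := by
    have hx : Measurable fun v : ℝ => exIndGT a k (v • x) :=
      (measurable_exIndGT a k).comp (hsmul.comp (measurable_prodMk_left (x := x)))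
    have hset : MeasurableSet {ω | a < |V ω * x k|} :=
      measurableSet_lt measurable_const (continuous_abs.measurable.comp (hV.mul_const _))
    rw [lintegral_map hx hV, ← lintegral_indicator_one hset]
    refine lintegral_congr fun ω => ?_
    simp [exIndGT, Set.indicator_apply]
  have := Measure.isProbabilityMeasure_map hV.aemeasurable (μ := μ)
  have := Measure.isProbabilityMeasure_map hΘ.aemeasurable (μ := μ)
  have hprod : μ.map (fun ω => (Θ ω, V ω)) = (μ.map Θ).prod (μ.map V) :=
    (indepFun_iff_map_prod_eq_prod_map_map hΘ.aemeasurable hV.aemeasurable).1 hind.symm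
  calc
    _ = ENNReal.ofReal (a ^ α) *
          ∫⁻ p, h p.1 * exIndGT a k (p.2 • p.1) ∂((μ.map Θ).prod (μ.map V)) := by
      rw [← hprod, lintegral_map hmeas (hΘ.prodMk hV)]
    _ = ENNReal.ofReal (a ^ α) *
          ∫⁻ x, h x * ∫⁻ v, exIndGT a k (v • x) ∂(μ.map V) ∂(μ.map Θ) := by
      rw [lintegral_prod _ hmeas.aemeasurable]
      congr 1
      refine lintegral_congr fun x => lintegral_const_mul (h x) ?_
      exact (measurable_exIndGT a k).comp (hsmul.comp (measurable_prodMk_left (x := x)))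
    _ = ∫⁻ x, h x * min (ENNReal.ofReal (a ^ α)) (ENNReal.ofReal (|x k| ^ α)) ∂(μ.map Θ) := by
      rw [← lintegral_const_mul' _ _ ENNReal.ofReal_ne_top]
      refine lintegral_congr fun x => ?_
      rw [hinner, mul_left_comm, hVp.rpow_mul_measure_lt hV hα ha]
    _ = _ := by
      refine lintegral_map ?_ hΘ
      fun_prop

/-- Let `|Θ_0| = 1` a.s., `V` Pareto(α)-distributed and independent of `Θ`,
and `Y := V·Θ`. If for every `s ∈ (0,1]`, measurable `h ≥ 0` and `k ∈ ℤ^d`,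
`E[h(θ_k Y) 1{|Y_k| > s}] = s^{−α} E[h(s·Y) 1{|Y_{−k}| > 1/s}]`, then the time-change
formula with index `α` holds for `Θ`. -/
theorem scaled_identity_implies_timeChange
    {Ω : Type*} [MeasurableSpace Ω] (μ : Measure Ω) [IsProbabilityMeasure μ]
    (Θ : Ω → RField d) (hΘ : Measurable Θ) (hΘ0 : ∀ᵐ ω ∂μ, |Θ ω 0| = 1)
    (α : ℝ) (hα : 0 < α)
    (V : Ω → ℝ) (hV : Measurable V) (hVp : IsPareto μ V α)
    (hind : IndepFun V Θ μ)
    (Y : Ω → RField d) (hYdef : Y = fun ω => V ω • Θ ω)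
    (hScaled : ∀ s : ℝ, 0 < s → s ≤ 1 → ∀ h : RField d → ℝ≥0∞, Measurable h →
      ∀ k : Fin d → ℤ,
        ∫⁻ ω, h (shift k (Y ω)) * exIndGT s k (Y ω) ∂μ
          = ENNReal.ofReal (s ^ (-α)) * ∫⁻ ω, h (s • Y ω) * exIndGT (1 / s) (-k) (Y ω) ∂μ) :
    TimeChange μ Θ α := by
  subst hYdef
  intro h hh k
  have hVpos : ∀ᵐ ω ∂μ, 0 < V ω := (hVp.ae_one_lt hV).mono fun _ => zero_lt_one.trans
  have hident (n : ℕ) :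
      ∫⁻ ω, h (originNormalize (shift k (Θ ω))) * exIndGT (1 / (n + 1 : ℝ)) k (V ω • Θ ω) ∂μ =
        ∫⁻ ω, h (Θ ω) * min (ENNReal.ofReal ((n + 1 : ℝ) ^ α))
          (ENNReal.ofReal (|Θ ω (-k)| ^ α)) ∂μ := by
    have hn : (0 : ℝ) < n + 1 := by positivity
    have hs := hScaled (1 / (n + 1 : ℝ)) (by positivity)
      ((div_le_one hn).2 (le_add_of_nonneg_left n.cast_nonneg))
      (h ∘ originNormalize) (hh.comp measurable_originNormalize) k
    rw [one_div_one_div, one_div, Real.inv_rpow hn.le, Real.rpow_neg hn.le, inv_inv,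
      ← one_div] at hs
    rw [← hVp.rpow_mul_lintegral_exIndGT hV hα hΘ hind hh hn]
    refine Eq.trans ?_ (hs.trans ?_)
    · refine lintegral_congr_ae ?_
      filter_upwards [hVpos] with ω hω
      rw [Function.comp_apply, shift_smul, originNormalize_smul hω]
    · congr 1
      refine lintegral_congr_ae ?_
      filter_upwards [hVpos, hΘ0] with ω hω hω'
      rw [Function.comp_apply, originNormalize_smul (by positivity), originNormalize_smul hω,
        originNormalize_of_abs_eq_one hω']
  have hsmul : Measurable fun ω => V ω • Θ ω :=
    measurable_pi_lambda _ fun i => hV.mul ((measurable_pi_apply i).comp hΘ)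
  have hleft : Tendsto (fun n : ℕ => ∫⁻ ω, h (originNormalize (shift k (Θ ω))) *
        exIndGT (1 / (n + 1 : ℝ)) k (V ω • Θ ω) ∂μ) atTop
      (nhds (∫⁻ ω, (if Θ ω k = 0 then 0 else h (|Θ ω k|⁻¹ • shift k (Θ ω))) ∂μ)) := by
    refine lintegral_tendsto_of_tendsto_of_monotone (fun n => ?_) ?_ ?_
    · exact ((hh.comp (measurable_originNormalize.comp ((measurable_shift k).comp hΘ))).mul
        ((measurable_exIndGT _ k).comp hsmul)).aemeasurable
    · refine ae_of_all _ fun ω m n hmn => ?_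
      exact mul_le_mul_right (exIndGT_antitone (by gcongr) k _) _
    · filter_upwards [hVpos] with ω hω
      refine tendsto_const_nhds.congr' ?_
      split_ifs with hk
      · refine Eventually.of_forall fun n => ?_
        have hn : ¬ (1 / (n + 1 : ℝ) < 0) := not_lt.2 (by positivity)
        simp only [exIndGT, Pi.smul_apply, hk, smul_zero, abs_zero, if_neg hn, mul_zero]
      · have hpos : 0 < |(V ω • Θ ω) k| := abs_pos.2 (mul_ne_zero hω.ne' hk)
        filter_upwards [tendsto_one_div_add_atTop_nhds_zero_nat.eventually_lt_const hpos] with n hn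
        rw [exIndGT, if_pos hn, mul_one, originNormalize_shift]
  have hright : Tendsto (fun n : ℕ => ∫⁻ ω, h (Θ ω) * min (ENNReal.ofReal ((n + 1 : ℝ) ^ α))
        (ENNReal.ofReal (|Θ ω (-k)| ^ α)) ∂μ) atTop
      (nhds (∫⁻ ω, h (Θ ω) * ENNReal.ofReal (|Θ ω (-k)| ^ α) ∂μ)) := by
    refine lintegral_tendsto_of_tendsto_of_monotone (fun n => ?_) ?_ ?_
    · fun_prop
    · refine ae_of_all _ fun ω m n hmn => ?_
      refine mul_le_mul_right (min_le_min_right _ (ENNReal.ofReal_le_ofReal ?_)) _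
      gcongr
    · refine ae_of_all _ fun ω => tendsto_const_nhds.congr' ?_
      filter_upwards [eventually_ge_atTop ⌈|Θ ω (-k)|⌉₊] with n hn
      rw [min_eq_right (ENNReal.ofReal_le_ofReal _)]
      have : |Θ ω (-k)| ≤ n + 1 := (Nat.ceil_le.1 hn).trans (le_add_of_nonneg_right zero_le_one)
      gcongr
  exact tendsto_nhds_unique (hleft.congr hident) hright
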